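/- The ternary quadratic form x² + y² + z² is strongly s-regular: for every positive integer n = n₁n₂ with n₁ a power of 2 and n₂ odd, r(n₁²n₂², f) = r(n₁², f) · ∏_{p | n₂} h_p(ord_p(n₂)). -/

import Mathlib

open Finset

/-- The value of the diagonal ternary form `a x² + b y² + c z²`. -/
def tVal (a b c : ℤ) (v : ℤ × ℤ × ℤ) : ℤ :=
  a * v.1 ^ 2 + b * v.2.1 ^ 2 + c * v.2.2 ^ 2

/-- The number of representations of `n` by the diagonal ternary form `a x² + b y² + c z²`. -/
noncomputable def tRep (a b c n : ℤ) : ℕ :=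
  Set.ncard {v : ℤ × ℤ × ℤ | tVal a b c v = n}

/-- The local factor `h_p(μ)` for a diagonal ternary form `a x² + b y² + c z²`. -/
def tHp (a b c : ℤ) (p : ℕ) (μ : ℕ) : ℤ :=
  ((p : ℤ) ^ (μ + 1) - 1) / ((p : ℤ) - 1) -
    jacobiSym (-(a * b * c)) p * (((p : ℤ) ^ μ - 1) / ((p : ℤ) - 1))

/-- The nontrivial Dirichlet character modulo `4`, as a function on the natural numbers. -/
def chi (n : ℕ) : ℤ := ZMod.χ₄ n

/-- The sum of `chi` over the divisors of `n`. -/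
def chiSum (n : ℕ) : ℤ := ∑ d ∈ n.divisors, chi d

/-- Pairs of odd positive integers with sum `2 * n`. -/
def oddPairs (n : ℕ) : Finset (ℕ × ℕ) :=
  (antidiagonal (2 * n)).filter fun x => Odd x.1

/-- Quadruples `((d, d'), (e, e'))` of odd positive integers with `d * d' + e * e' = 2 * n`. -/
def oddQuads (n : ℕ) : Finset ((ℕ × ℕ) × (ℕ × ℕ)) :=
  ((range (2 * n + 1) ×ˢ range (2 * n + 1)) ×ˢ (range (2 * n + 1) ×ˢ range (2 * n + 1))).filter
    fun w => (Odd w.1.1 ∧ Odd w.1.2 ∧ Odd w.2.1 ∧ Odd w.2.2) ∧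
      w.1.1 * w.1.2 + w.2.1 * w.2.2 = 2 * n

lemma chi_mul (a b : ℕ) : chi (a * b) = chi a * chi b := by
  simp only [chi, Nat.cast_mul, map_mul]

lemma chi_one : chi 1 = 1 := by simp [chi]

lemma chi_mul_self {a : ℕ} (ha : Odd a) : chi a * chi a = 1 := by
  rw [Nat.odd_iff] at ha
  rcases (by omega : a % 4 = 1 ∨ a % 4 = 3) with h | h
  · simp [chi, ZMod.χ₄_nat_one_mod_four h]
  · simp [chi, ZMod.χ₄_nat_three_mod_four h]

lemma chi_of_even {a : ℕ} (ha : ¬ Odd a) : chi a = 0 := by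
  rw [Nat.not_odd_iff] at ha
  rw [chi, ZMod.χ₄_nat_eq_if_mod_four, if_pos ha]

lemma chi_add_two_mul {a : ℕ} (ha : Odd a) (k : ℕ) :
    chi (a + 2 * k) * chi a = (-1) ^ k := by
  rw [Nat.odd_iff] at ha
  rcases Nat.even_or_odd k with hk | hk
  · rw [hk.neg_one_pow]
    rw [Nat.even_iff] at hk
    rcases (by omega : a % 4 = 1 ∨ a % 4 = 3) with h | h
    · simp only [chi]
      rw [ZMod.χ₄_nat_one_mod_four h, ZMod.χ₄_nat_one_mod_four (by omega)]; norm_num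
    · simp only [chi]
      rw [ZMod.χ₄_nat_three_mod_four h, ZMod.χ₄_nat_three_mod_four (by omega)]; norm_num
  · rw [hk.neg_one_pow]
    rw [Nat.odd_iff] at hk
    rcases (by omega : a % 4 = 1 ∨ a % 4 = 3) with h | h
    · simp only [chi]
      rw [ZMod.χ₄_nat_one_mod_four h, ZMod.χ₄_nat_three_mod_four (by omega)]; norm_num
    · simp only [chi]
      rw [ZMod.χ₄_nat_three_mod_four h, ZMod.χ₄_nat_one_mod_four (by omega)]; norm_num

lemma mem_oddPairs {n : ℕ} {x : ℕ × ℕ} :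
    x ∈ oddPairs n ↔ x.1 + x.2 = 2 * n ∧ Odd x.1 := by
  simp [oddPairs]

lemma mem_oddQuads {n : ℕ} {w : (ℕ × ℕ) × (ℕ × ℕ)} :
    w ∈ oddQuads n ↔ (Odd w.1.1 ∧ Odd w.1.2 ∧ Odd w.2.1 ∧ Odd w.2.2) ∧
      w.1.1 * w.1.2 + w.2.1 * w.2.2 = 2 * n := by
  simp only [oddQuads, mem_filter, mem_product, mem_range, and_iff_right_iff_imp]
  rintro ⟨⟨h1, h2, h3, h4⟩, h⟩
  have := h1.pos
  have := h2.pos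
  have := h3.pos
  have := h4.pos
  refine ⟨⟨?_, ?_⟩, ?_, ?_⟩ <;> nlinarith

lemma card_oddPairs (n : ℕ) : (oddPairs n).card = n := by
  conv_rhs => rw [← card_range n]
  symm
  refine card_bij (fun i _ => (2 * i + 1, 2 * n - (2 * i + 1))) ?_ ?_ ?_
  · intro i hi
    rw [mem_range] at hi
    rw [mem_oddPairs]
    exact ⟨by dsimp only; omega, by simp⟩
  · intro i _ j _ h
    simp only [Prod.mk.injEq] at h
    omega
  · rintro ⟨a, b⟩ h
    rw [mem_oddPairs] at h
    obtain ⟨h, k, hk⟩ := h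
    dsimp only at h hk
    refine ⟨k, by rw [mem_range]; omega, ?_⟩
    simp only [Prod.mk.injEq]
    omega

lemma sum_oddPairs_chiSum_mul_chiSum (n : ℕ) :
    ∑ x ∈ oddPairs n, chiSum x.1 * chiSum x.2 = ∑ w ∈ oddQuads n, chi w.1.1 * chi w.2.1 := by
  have hmaps : ∀ w ∈ oddQuads n, (w.1.1 * w.1.2, w.2.1 * w.2.2) ∈ oddPairs n := by
    intro w hw
    rw [mem_oddQuads] at hw
    rw [mem_oddPairs]
    exact ⟨hw.2, hw.1.1.mul hw.1.2.1⟩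
  rw [← sum_fiberwise_of_maps_to hmaps]
  refine sum_congr rfl fun x hx => ?_
  have hfib : (oddQuads n).filter (fun w => (w.1.1 * w.1.2, w.2.1 * w.2.2) = x) =
      x.1.divisorsAntidiagonal ×ˢ x.2.divisorsAntidiagonal := by
    ext ⟨⟨d, d'⟩, ⟨e, e'⟩⟩
    obtain ⟨a, b⟩ := x
    rw [mem_oddPairs] at hx
    obtain ⟨hab, ha⟩ := hx
    have hb : Odd b := by
      dsimp only at hab ha
      rw [Nat.odd_iff] at *
      omega
    simp only [mem_filter, mem_oddQuads, mem_product, Nat.mem_divisorsAntidiagonal,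
      Prod.mk.injEq]
    constructor
    · rintro ⟨_, h1, h2⟩
      exact ⟨⟨h1, ha.pos.ne'⟩, h2, hb.pos.ne'⟩
    · rintro ⟨⟨h1, _⟩, h2, _⟩
      dsimp only at hab ha
      rw [← h1, Nat.odd_mul] at ha
      rw [← h2, Nat.odd_mul] at hb
      exact ⟨⟨⟨ha.1, ha.2, hb.1, hb.2⟩, by rw [h1, h2, hab]⟩, h1, h2⟩
  rw [hfib, sum_product]
  have hsum (a : ℕ) : chiSum a = ∑ y ∈ a.divisorsAntidiagonal, chi y.1 :=
    (Nat.sum_divisorsAntidiagonal fun d _ => chi d).symm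
  rw [hsum, hsum, sum_mul_sum]

/-- An involution on the quadruples with `d > e` which reverses the sign of
`chi d * chi e`. -/
def quadFlip (w : (ℕ × ℕ) × (ℕ × ℕ)) : (ℕ × ℕ) × (ℕ × ℕ) :=
  ((w.1.2 + w.2.1 / (w.1.1 - w.2.1) * (w.1.2 + w.2.2) + (w.1.2 + w.2.2),
    w.2.1 % (w.1.1 - w.2.1)),
   (w.1.2 + w.2.1 / (w.1.1 - w.2.1) * (w.1.2 + w.2.2),
    (w.1.1 - w.2.1) - w.2.1 % (w.1.1 - w.2.1)))

lemma sum_oddQuads_gt {n : ℕ} (hn : Odd n) :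
    ∑ w ∈ (oddQuads n).filter (fun w => w.2.1 < w.1.1), chi w.1.1 * chi w.2.1 = 0 := by
  have key : ∀ w ∈ (oddQuads n).filter (fun w => w.2.1 < w.1.1), ∃ D S t r d' : ℕ,
      0 < D ∧ 0 < S ∧ Odd r ∧ r < 2 * D ∧ Odd d' ∧ d' < 2 * S ∧ Odd (D + S) ∧
      D * d' + (2 * D * t + r) * S = n ∧
      w = ((2 * D * t + r + 2 * D, d'), (2 * D * t + r, 2 * S - d')) := by
    rintro ⟨⟨d, d'⟩, ⟨e, e'⟩⟩ hw
    simp only [mem_filter, mem_oddQuads] at hw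
    obtain ⟨⟨⟨h1, h2, h3, h4⟩, h⟩, hlt⟩ := hw
    obtain ⟨D, hD⟩ : ∃ D, d = e + 2 * D := by
      rw [Nat.odd_iff] at *
      exact ⟨(d - e) / 2, by omega⟩
    obtain ⟨S, hS⟩ : ∃ S, d' + e' = 2 * S := by
      rw [Nat.odd_iff] at *
      exact ⟨(d' + e') / 2, by omega⟩
    have he' := h4.pos
    have hd' := h2.pos
    have hdm := Nat.div_add_mod e (2 * D)
    have hDpos : 0 < D := by omega
    have heq : D * d' + e * S = n := by
      subst hD
      obtain rfl : e' = 2 * S - d' := by omega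
      zify [show d' ≤ 2 * S by omega] at h ⊢
      linarith
    refine ⟨D, S, e / (2 * D), e % (2 * D), d', hDpos, by omega, ?_,
      Nat.mod_lt _ (by omega), h2, by omega, ?_, by rw [hdm, heq], ?_⟩
    · have : Odd (2 * D * (e / (2 * D)) + e % (2 * D)) := by rwa [hdm]
      rw [mul_assoc] at this
      rw [Nat.odd_iff] at *
      omega
    · rw [← heq, Nat.odd_add, Nat.odd_mul, Nat.even_mul] at hn
      rw [Nat.odd_add]
      have := Nat.not_even_iff_odd.mpr h3
      tauto
    · rw [hdm, hD]
      simp only [Prod.mk.injEq, true_and]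
      omega
  have flip_eq : ∀ D S t r d' : ℕ, 0 < D → r < 2 * D → d' < 2 * S →
      quadFlip ((2 * D * t + r + 2 * D, d'), (2 * D * t + r, 2 * S - d')) =
        ((2 * S * t + d' + 2 * S, r), (2 * S * t + d', 2 * D - r)) := by
    intro D S t r d' hD hr hd'
    have e1 : 2 * D * t + r + 2 * D - (2 * D * t + r) = 2 * D := by omega
    have e2 : d' + (2 * S - d') = 2 * S := by omega
    have e3 : (2 * D * t + r) / (2 * D) = t := by
      rw [Nat.mul_add_div (by omega), Nat.div_eq_of_lt hr, add_zero]
    have e4 : (2 * D * t + r) % (2 * D) = r := by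
      rw [Nat.mul_add_mod, Nat.mod_eq_of_lt hr]
    simp only [quadFlip, e1, e2, e3, e4, Prod.mk.injEq, and_true]
    exact ⟨by ring, by ring⟩
  have odd_add : ∀ {r : ℕ} (D t : ℕ), Odd r → Odd (2 * D * t + r) := by
    intro r D t hr
    rw [mul_assoc]
    exact (even_two_mul _).add_odd hr
  refine sum_involution (fun w _ => quadFlip w) ?_ ?_ ?_ ?_
  · intro w hw
    obtain ⟨D, S, t, r, d', hD, hS, hr, hrD, hd, hdS, hDS, -, rfl⟩ := key w hw
    rw [flip_eq D S t r d' hD hrD hdS, chi_add_two_mul (odd_add _ _ hr),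
      chi_add_two_mul (odd_add _ _ hd)]
    rcases Nat.even_or_odd D with h | h
    · have hS' : Odd S := by rw [Nat.odd_add] at hDS; grind
      rw [h.neg_one_pow, hS'.neg_one_pow]; norm_num
    · have hS' : Even S := by rw [Nat.odd_add] at hDS; grind
      rw [h.neg_one_pow, hS'.neg_one_pow]; norm_num
  · intro w hw _ heq
    obtain ⟨D, S, t, r, d', hD, hS, hr, hrD, hd, hdS, hDS, -, rfl⟩ := key w hw
    rw [flip_eq D S t r d' hD hrD hdS] at heq
    simp only [Prod.mk.injEq] at heq
    have : D = S := by omega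
    subst this
    exact (Nat.not_even_iff_odd.mpr hDS) (Even.add_self D)
  · intro w hw
    obtain ⟨D, S, t, r, d', hD, hS, hr, hrD, hd, hdS, hDS, heq, rfl⟩ := key w hw
    rw [flip_eq D S t r d' hD hrD hdS]
    simp only [mem_filter, mem_oddQuads]
    refine ⟨⟨⟨?_, hr, odd_add _ _ hd, ?_⟩, ?_⟩, by omega⟩
    · exact (odd_add _ _ hd).add_even (even_two_mul _)
    · rw [Nat.odd_iff] at *
      omega
    · zify [hrD.le] at *
      linear_combination 2 * heq
  · intro w hw
    obtain ⟨D, S, t, r, d', hD, hS, hr, hrD, hd, hdS, hDS, heq, rfl⟩ := key w hw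
    simp only [flip_eq D S t r d' hD hrD hdS, flip_eq S D t d' r hS hdS hrD]

lemma sum_oddQuads_diag {n : ℕ} (hn : Odd n) :
    ∑ w ∈ (oddQuads n).filter (fun w => w.1.1 = w.2.1), chi w.1.1 * chi w.2.1 =
      ∑ d ∈ n.divisors, (d : ℤ) := by
  have hmaps : ∀ w ∈ (oddQuads n).filter (fun w => w.1.1 = w.2.1), w.1.1 ∈ n.divisors := by
    rintro ⟨⟨d, d'⟩, ⟨e, e'⟩⟩ hw
    simp only [mem_filter, mem_oddQuads] at hw
    obtain ⟨⟨⟨h1, h2, h3, h4⟩, h⟩, rfl⟩ := hw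
    rw [Nat.mem_divisors]
    refine ⟨?_, hn.pos.ne'⟩
    have : d ∣ 2 * n := ⟨d' + e', by rw [← h]; ring⟩
    exact (Nat.coprime_two_right.mpr h1).dvd_of_dvd_mul_left this
  rw [← sum_fiberwise_of_maps_to hmaps, ← Nat.sum_div_divisors n (fun d => (d : ℤ))]
  refine sum_congr rfl fun d hd => ?_
  have hdn := Nat.dvd_of_mem_divisors hd
  have hd_odd : Odd d := hn.of_dvd_nat hdn
  have hone : ∀ w ∈ ((oddQuads n).filter (fun w => w.1.1 = w.2.1)).filter (fun w => w.1.1 = d),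
      chi w.1.1 * chi w.2.1 = 1 := by
    intro w hw
    simp only [mem_filter] at hw
    rw [← hw.1.2, hw.2, chi_mul_self hd_odd]
  rw [sum_congr rfl hone, sum_const, nsmul_eq_mul, mul_one]
  norm_cast
  rw [← card_oddPairs (n / d)]
  symm
  obtain ⟨m, rfl⟩ := hdn
  rw [Nat.mul_div_cancel_left _ hd_odd.pos]
  refine card_bij (fun x _ => ((d, x.1), (d, x.2))) ?_ ?_ ?_
  · rintro ⟨a, b⟩ hx
    simp only [mem_oddPairs] at hx
    simp only [mem_filter, mem_oddQuads, and_true]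
    refine ⟨⟨hd_odd, hx.2, hd_odd, ?_⟩, ?_⟩
    · have := hx.1
      have := hx.2
      rw [Nat.odd_iff] at *
      omega
    · rw [← mul_add, hx.1]; ring
  · rintro ⟨a, b⟩ _ ⟨a', b'⟩ _ h
    simpa using h
  · rintro ⟨⟨x, d'⟩, ⟨e, e'⟩⟩ hw
    simp only [mem_filter, mem_oddQuads] at hw
    obtain ⟨⟨⟨⟨h1, h2, h3, h4⟩, h⟩, rfl⟩, rfl⟩ := hw
    refine ⟨(d', e'), ?_, rfl⟩
    rw [mem_oddPairs]
    refine ⟨?_, h2⟩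
    refine Nat.eq_of_mul_eq_mul_left h1.pos ?_
    dsimp only
    rw [mul_add, h]; ring

lemma sum_oddPairs_chiSum {n : ℕ} (hn : Odd n) :
    ∑ x ∈ oddPairs n, chiSum x.1 * chiSum x.2 = ∑ d ∈ n.divisors, (d : ℤ) := by
  have hlt : ∑ w ∈ (oddQuads n).filter (fun w => w.1.1 < w.2.1), chi w.1.1 * chi w.2.1 = 0 := by
    rw [← sum_oddQuads_gt hn]
    refine sum_bij' (fun w _ => w.swap) (fun w _ => w.swap) ?_ ?_ ?_ ?_ ?_
    · rintro w hw
      simp only [mem_filter, mem_oddQuads, Prod.fst_swap, Prod.snd_swap] at hw ⊢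
      exact ⟨⟨by tauto, by rw [add_comm]; exact hw.1.2⟩, hw.2⟩
    · rintro w hw
      simp only [mem_filter, mem_oddQuads, Prod.fst_swap, Prod.snd_swap] at hw ⊢
      exact ⟨⟨by tauto, by rw [add_comm]; exact hw.1.2⟩, hw.2⟩
    · simp
    · simp
    · intro w _
      simp [mul_comm]
  rw [sum_oddPairs_chiSum_mul_chiSum,
    ← sum_filter_add_sum_filter_not _ (fun w => w.1.1 = w.2.1), sum_oddQuads_diag hn,
    ← sum_filter_add_sum_filter_not ((oddQuads n).filter fun w => ¬ w.1.1 = w.2.1)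
      (fun w => w.1.1 < w.2.1), filter_filter, filter_filter]
  have e1 : (oddQuads n).filter (fun w => ¬ w.1.1 = w.2.1 ∧ w.1.1 < w.2.1) =
      (oddQuads n).filter (fun w => w.1.1 < w.2.1) := filter_congr (by grind)
  have e2 : (oddQuads n).filter (fun w => ¬ w.1.1 = w.2.1 ∧ ¬ w.1.1 < w.2.1) =
      (oddQuads n).filter (fun w => w.2.1 < w.1.1) := filter_congr (by grind)
  rw [e1, e2, hlt, sum_oddQuads_gt hn]
  ring

lemma chiSum_mul_eq_sum_coprime {a b : ℕ} (ha : 0 < a) (hb : 0 < b) :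
    chiSum (a * b) = ∑ x ∈ (a.divisors ×ˢ b.divisors).filter
      (fun x => Nat.Coprime x.2 (a / x.1)), chi x.1 * chi x.2 := by
  have gcd_eq : ∀ g e : ℕ, g ∣ a → Nat.Coprime e (a / g) → Nat.gcd (g * e) a = g := by
    rintro g e ⟨c, rfl⟩ h
    have hg : 0 < g := Nat.pos_of_mul_pos_right ha
    rw [Nat.mul_div_cancel_left _ hg] at h
    rw [Nat.gcd_mul_left, h.gcd_eq_one, mul_one]
  symm
  refine sum_bij' (fun x _ => x.1 * x.2) (fun D _ => (Nat.gcd D a, D / Nat.gcd D a))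
    ?_ ?_ ?_ ?_ ?_
  · rintro ⟨g, e⟩ hx
    simp only [mem_filter, mem_product, Nat.mem_divisors] at hx ⊢
    exact ⟨mul_dvd_mul hx.1.1.1 hx.1.2.1, (Nat.mul_pos ha hb).ne'⟩
  · intro D hD
    have hDab := Nat.dvd_of_mem_divisors hD
    have hg : 0 < Nat.gcd D a := Nat.gcd_pos_of_pos_right _ ha
    have hcop : Nat.Coprime (D / Nat.gcd D a) (a / Nat.gcd D a) := Nat.coprime_div_gcd_div_gcd hg
    simp only [mem_filter, mem_product, Nat.mem_divisors]
    refine ⟨⟨⟨Nat.gcd_dvd_right _ _, ha.ne'⟩, ?_, hb.ne'⟩, hcop⟩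
    refine hcop.dvd_of_dvd_mul_left ?_
    refine Nat.dvd_of_mul_dvd_mul_left hg ?_
    rw [← mul_assoc, Nat.mul_div_cancel' (Nat.gcd_dvd_left _ _),
      Nat.mul_div_cancel' (Nat.gcd_dvd_right _ _)]
    exact hDab
  · rintro ⟨g, e⟩ hx
    simp only [mem_filter, mem_product, Nat.mem_divisors] at hx
    have h := gcd_eq g e hx.1.1.1 hx.2
    have hg : 0 < g := Nat.pos_of_dvd_of_pos hx.1.1.1 ha
    simp only [h, Nat.mul_div_cancel_left _ hg]
  · intro D _
    exact Nat.mul_div_cancel' (Nat.gcd_dvd_left _ _)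
  · intro x _
    rw [chi_mul]

lemma chiSum_mul_chiSum {a b : ℕ} (ha : 0 < a) (hb : 0 < b) :
    chiSum a * chiSum b =
      ∑ d ∈ (Nat.gcd a b).divisors, chi d * chiSum (a / d * (b / d)) := by
  have hmaps : ∀ x ∈ a.divisors ×ˢ b.divisors,
      Nat.gcd x.2 (a / x.1) ∈ (Nat.gcd a b).divisors := by
    intro x hx
    simp only [mem_product, Nat.mem_divisors] at hx
    rw [Nat.mem_divisors]
    exact ⟨Nat.dvd_gcd ((Nat.gcd_dvd_right _ _).trans (Nat.div_dvd_of_dvd hx.1.1))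
      ((Nat.gcd_dvd_left _ _).trans hx.2.1), (Nat.gcd_pos_of_pos_left _ ha).ne'⟩
  rw [chiSum, chiSum, sum_mul_sum, ← sum_product', ← sum_fiberwise_of_maps_to hmaps]
  refine sum_congr rfl fun d hd => ?_
  have hd' := Nat.dvd_of_mem_divisors hd
  obtain ⟨a', rfl⟩ := hd'.trans (Nat.gcd_dvd_left _ _)
  obtain ⟨b', rfl⟩ := hd'.trans (Nat.gcd_dvd_right _ _)
  have hd0 : 0 < d := Nat.pos_of_mul_pos_right ha
  have ha' : 0 < a' := Nat.pos_of_mul_pos_left ha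
  have hb' : 0 < b' := Nat.pos_of_mul_pos_left hb
  rw [Nat.mul_div_cancel_left _ hd0, Nat.mul_div_cancel_left _ hd0,
    chiSum_mul_eq_sum_coprime ha' hb', mul_sum]
  symm
  refine sum_bij (fun x _ => (x.1, d * x.2)) ?_ ?_ ?_ ?_
  · rintro ⟨g, e⟩ hx
    simp only [mem_filter, mem_product, Nat.mem_divisors] at hx ⊢
    obtain ⟨⟨⟨hg, -⟩, he, -⟩, hc⟩ := hx
    refine ⟨⟨⟨hg.mul_left d, ha.ne'⟩, mul_dvd_mul_left d he, hb.ne'⟩, ?_⟩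
    rw [Nat.mul_div_assoc _ hg, Nat.gcd_mul_left, hc.gcd_eq_one, mul_one]
  · rintro ⟨g, e⟩ _ ⟨g', e'⟩ _ h
    simp only [Prod.mk.injEq] at h
    exact Prod.ext h.1 (Nat.eq_of_mul_eq_mul_left hd0 h.2)
  · rintro ⟨g, e⟩ hx
    simp only [mem_filter, mem_product, Nat.mem_divisors] at hx
    obtain ⟨⟨⟨hg, -⟩, he, -⟩, hc⟩ := hx
    have hde : d ∣ e := hc ▸ Nat.gcd_dvd_left _ _
    have hdg : d ∣ d * a' / g := by
      have := Nat.gcd_dvd_right e (d * a' / g)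
      rwa [hc] at this
    obtain ⟨e', rfl⟩ := hde
    obtain ⟨c, hcc⟩ := hdg
    have hac : d * a' = g * (d * c) := by rw [← hcc, Nat.mul_div_cancel' hg]
    have hgc : a' = g * c := Nat.eq_of_mul_eq_mul_left hd0 (by rw [hac]; ring)
    have hg0 : 0 < g := Nat.pos_of_dvd_of_pos hg ha
    refine ⟨(g, e'), ?_, rfl⟩
    simp only [mem_filter, mem_product, Nat.mem_divisors]
    refine ⟨⟨⟨⟨c, hgc⟩, ha'.ne'⟩, Nat.dvd_of_mul_dvd_mul_left hd0 he, hb'.ne'⟩, ?_⟩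
    rw [hcc, Nat.gcd_mul_left] at hc
    rw [hgc, Nat.mul_div_cancel_left _ hg0]
    exact Nat.eq_of_mul_eq_mul_left hd0 (by rw [hc, mul_one])
  · intro x _
    simp only [chi_mul]
    ring

/-- The sum of `chiSum (a * b)` over the pairs of odd positive integers with
`a + b = 2 * n`. -/
def pairSum (n : ℕ) : ℤ := ∑ x ∈ oddPairs n, chiSum (x.1 * x.2)

lemma sum_chi_mul_pairSum {n : ℕ} (hn : Odd n) :
    ∑ d ∈ n.divisors, chi d * pairSum (n / d) = ∑ d ∈ n.divisors, (d : ℤ) := by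
  have snd_odd : ∀ x ∈ oddPairs n, Odd x.2 := by
    intro x hx
    rw [mem_oddPairs] at hx
    obtain ⟨h1, h2⟩ := hx
    rw [Nat.odd_iff] at *
    omega
  rw [← sum_oddPairs_chiSum hn]
  have hexp : ∀ x ∈ oddPairs n, chiSum x.1 * chiSum x.2 =
      ∑ d ∈ (Nat.gcd x.1 x.2).divisors, chi d * chiSum (x.1 / d * (x.2 / d)) := fun x hx =>
    chiSum_mul_chiSum (mem_oddPairs.mp hx).2.pos (snd_odd x hx).pos
  rw [sum_congr rfl hexp]
  simp only [pairSum, mul_sum]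
  rw [sum_sigma', sum_sigma']
  refine sum_bij' (fun y _ => ⟨(y.1 * y.2.1, y.1 * y.2.2), y.1⟩)
    (fun y _ => ⟨y.2, (y.1.1 / y.2, y.1.2 / y.2)⟩) ?_ ?_ ?_ ?_ ?_
  · rintro ⟨d, a, b⟩ h
    simp only [mem_sigma, mem_oddPairs, Nat.mem_divisors] at h ⊢
    obtain ⟨⟨⟨m, rfl⟩, hn0⟩, hab, ha⟩ := h
    rw [Nat.odd_mul] at hn
    rw [Nat.mul_div_cancel_left _ hn.1.pos] at hab
    refine ⟨⟨?_, hn.1.mul ha⟩, Nat.dvd_gcd (dvd_mul_right _ _) (dvd_mul_right _ _), ?_⟩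
    · rw [← mul_add, hab]; ring
    · exact (Nat.gcd_pos_of_pos_left _ (hn.1.mul ha).pos).ne'
  · rintro ⟨⟨a, b⟩, d⟩ h
    simp only [mem_sigma, mem_oddPairs, Nat.mem_divisors] at h ⊢
    obtain ⟨⟨hab, ha⟩, hd, -⟩ := h
    obtain ⟨a', rfl⟩ := hd.trans (Nat.gcd_dvd_left _ _)
    obtain ⟨b', rfl⟩ := hd.trans (Nat.gcd_dvd_right _ _)
    rw [Nat.odd_mul] at ha
    rw [← mul_add] at hab
    have hdn : d ∣ n :=
      (Nat.coprime_two_right.mpr ha.1).dvd_of_dvd_mul_left ⟨_, hab.symm⟩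
    obtain ⟨m, rfl⟩ := hdn
    simp only [Nat.mul_div_cancel_left _ ha.1.pos]
    refine ⟨⟨dvd_mul_right _ _, hn.pos.ne'⟩, ?_, ha.2⟩
    exact Nat.eq_of_mul_eq_mul_left ha.1.pos (by rw [hab]; ring)
  · rintro ⟨d, a, b⟩ h
    have hd : 0 < d := Nat.pos_of_mem_divisors (mem_sigma.mp h).1
    simp only [Nat.mul_div_cancel_left _ hd]
  · rintro ⟨⟨a, b⟩, d⟩ h
    simp only [mem_sigma, Nat.mem_divisors] at h
    have h1 := h.2.1.trans (Nat.gcd_dvd_left _ _)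
    have h2 := h.2.1.trans (Nat.gcd_dvd_right _ _)
    simp only [Nat.mul_div_cancel' h1, Nat.mul_div_cancel' h2]
  · rintro ⟨d, a, b⟩ h
    have hd : 0 < d := Nat.pos_of_mem_divisors (mem_sigma.mp h).1
    simp only [Nat.mul_div_cancel_left _ hd]

open ArithmeticFunction in
lemma pairSum_eq_prod {n : ℕ} (hn : Odd n) :
    pairSum n = ∏ p ∈ n.primeFactors, pairSum (p ^ n.factorization p) := by
  let X : ArithmeticFunction ℤ := ⟨chi, by simp [chi]⟩
  have hX : X.IsMultiplicative := ⟨chi_one, fun _ => chi_mul _ _⟩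
  let T : ArithmeticFunction ℤ := X.pmul (sigma 1 : ArithmeticFunction ℕ)
  have hT : T.IsMultiplicative := hX.pmul isMultiplicative_sigma.natCast
  have hH : ((moebius : ArithmeticFunction ℤ) * T).IsMultiplicative :=
    isMultiplicative_moebius.mul hT
  have hodd : ∀ m : ℕ, Odd m → chi m * pairSum m = (moebius * T) m := by
    have h := (sum_eq_iff_sum_mul_moebius_eq_on (f := fun m => chi m * pairSum m)
      (g := fun m => T m) {m | Odd m} (fun m k hmk hk => hk.of_dvd_nat hmk)).mp ?_
    · intro m hm
      rw [← h m hm.pos hm, ArithmeticFunction.mul_apply]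
      simp
    · intro m _ hm
      have hs := sum_chi_mul_pairSum hm
      have hTm : T m = chi m * ∑ d ∈ m.divisors, (d : ℤ) := by
        change X m * (sigma 1 m : ℤ) = _
        rw [sigma_one_apply, Nat.cast_sum]
        rfl
      rw [hTm, ← hs, mul_sum, ← Nat.sum_div_divisors m]
      refine sum_congr rfl fun d hd => ?_
      obtain ⟨k, rfl⟩ := Nat.dvd_of_mem_divisors hd
      replace hm : Odd (d * k) := hm
      rw [Nat.odd_mul] at hm
      rw [Nat.mul_div_cancel_left _ hm.1.pos, chi_mul]
      linear_combination (-chi k * pairSum k) * chi_mul_self hm.1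
  have hmul : ∀ m : ℕ, Odd m → pairSum m = (X.pmul (moebius * T)) m := by
    intro m hm
    have hXm : X m = chi m := rfl
    rw [pmul_apply, ← hodd m hm, hXm]
    linear_combination (- pairSum m) * chi_mul_self hm
  rw [hmul n hn, (hX.pmul hH).multiplicative_factorization _ hn.pos.ne', Finsupp.prod,
    Nat.support_factorization]
  refine prod_congr rfl fun p hp => ?_
  rw [hmul]
  exact (hn.of_dvd_nat (Nat.dvd_of_mem_primeFactors hp)).pow

lemma pairSum_prime_pow {p : ℕ} (hp : p.Prime) (hodd : Odd p) (k : ℕ) :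
    pairSum (p ^ (k + 1)) =
      ∑ i ∈ range (k + 2), (p : ℤ) ^ i - chi p * ∑ i ∈ range (k + 1), (p : ℤ) ^ i := by
  have h1 := sum_chi_mul_pairSum (hodd.pow (n := k + 1))
  have h0 := sum_chi_mul_pairSum (hodd.pow (n := k))
  simp only [Nat.sum_divisors_prime_pow hp, Nat.cast_pow] at h0 h1
  rw [sum_range_succ'] at h1
  have h : ∑ i ∈ range (k + 1), chi (p ^ (i + 1)) * pairSum (p ^ (k + 1) / p ^ (i + 1)) =
      chi p * ∑ i ∈ range (k + 1), chi (p ^ i) * pairSum (p ^ k / p ^ i) := by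
    rw [mul_sum]
    refine sum_congr rfl fun i _ => ?_
    rw [pow_succ' p i, pow_succ' p k, Nat.mul_div_mul_left _ _ hp.pos, chi_mul, mul_assoc]
  rw [h, h0] at h1
  simp only [pow_zero, chi_one, one_mul, Nat.div_one] at h1
  linear_combination h1

/-- The number of Gaussian integers of norm `m`. -/
noncomputable def gaussRep (m : ℕ) : ℕ := Set.ncard {z : GaussianInt | z.norm = m}

lemma gaussianInt_norm_eq (z : GaussianInt) : z.norm = z.re ^ 2 + z.im ^ 2 := by
  rw [Zsqrtd.norm_def]
  ring

lemma abs_le_of_sq_add_eq {x y m : ℤ} (hy : 0 ≤ y) (h : x ^ 2 + y = m) : -m ≤ x ∧ x ≤ m := by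
  constructor <;> nlinarith [Int.le_self_sq x, Int.le_self_sq (-x)]

lemma finite_norm_eq (m : ℕ) : {z : GaussianInt | z.norm = m}.Finite := by
  have hinj : Function.Injective fun z : GaussianInt => (z.re, z.im) := by
    intro z w h
    simp only [Prod.mk.injEq] at h
    exact Zsqrtd.ext h.1 h.2
  refine Set.Finite.subset (Set.Finite.preimage hinj.injOn
    ((Set.finite_Icc (-(m : ℤ)) m).prod (Set.finite_Icc (-(m : ℤ)) m))) ?_
  intro z hz
  rw [Set.mem_ofPred_eq, gaussianInt_norm_eq] at hz
  simp only [Set.mem_preimage, Set.mem_prod, Set.mem_Icc]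
  exact ⟨abs_le_of_sq_add_eq (sq_nonneg _) hz,
    abs_le_of_sq_add_eq (sq_nonneg _) (by rw [add_comm]; exact hz)⟩

lemma gaussRep_one : gaussRep 1 = 4 := by
  have h : {z : GaussianInt | z.norm = (1 : ℕ)} =
      (({⟨1, 0⟩, ⟨-1, 0⟩, ⟨0, 1⟩, ⟨0, -1⟩} : Finset GaussianInt) : Set GaussianInt) := by
    ext ⟨x, y⟩
    simp only [Set.mem_ofPred_eq, gaussianInt_norm_eq, coe_insert, coe_singleton,
      Set.mem_insert_iff, Set.mem_singleton_iff, Zsqrtd.ext_iff]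
    constructor
    · intro h
      obtain ⟨hx, hx'⟩ := abs_le_of_sq_add_eq (sq_nonneg _) h
      obtain ⟨hy, hy'⟩ := abs_le_of_sq_add_eq (sq_nonneg x) ((add_comm _ _).trans h)
      push_cast at *
      interval_cases x <;> interval_cases y <;> simp_all
    · rintro (⟨rfl, rfl⟩ | ⟨rfl, rfl⟩ | ⟨rfl, rfl⟩ | ⟨rfl, rfl⟩) <;> norm_num
  rw [gaussRep, h, Set.ncard_coe_finset]
  decide

lemma ncard_norm_eq_and_dvd {α : GaussianInt} {k : ℕ} (hk : 0 < k) (hα : α.norm = k) (m : ℕ) :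
    Set.ncard {z : GaussianInt | z.norm = (k * m : ℕ) ∧ α ∣ z} = gaussRep m := by
  have hα0 : α ≠ 0 := by
    rintro rfl
    rw [Zsqrtd.norm_zero] at hα
    omega
  rw [gaussRep, ← Set.ncard_image_of_injective {z : GaussianInt | z.norm = m}
    (mul_right_injective₀ hα0)]
  congr 1
  ext z
  simp only [Set.mem_ofPred_eq, Set.mem_image]
  have hk' : (k : ℤ) ≠ 0 := by exact_mod_cast hk.ne'
  constructor
  · rintro ⟨h, w, rfl⟩
    refine ⟨w, ?_, rfl⟩
    rw [Zsqrtd.norm_mul, hα] at h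
    push_cast at h
    exact mul_left_cancel₀ hk' h
  · rintro ⟨w, hw, rfl⟩
    refine ⟨?_, dvd_mul_right _ _⟩
    rw [Zsqrtd.norm_mul, hα, hw]
    push_cast
    ring

lemma ncard_norm_eq_and_prime_dvd {p : ℕ} (hp : p.Prime) (m : ℕ) :
    Set.ncard {z : GaussianInt | z.norm = (p * m : ℕ) ∧ (p : GaussianInt) ∣ z} =
      if p ∣ m then gaussRep (m / p) else 0 := by
  split_ifs with h
  · obtain ⟨k, rfl⟩ := h
    rw [Nat.mul_div_cancel_left _ hp.pos, ← mul_assoc]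
    exact ncard_norm_eq_and_dvd (Nat.mul_pos hp.pos hp.pos)
      (by rw [Zsqrtd.norm_natCast]; push_cast; ring) k
  · have hempty : {z : GaussianInt | z.norm = (p * m : ℕ) ∧ (p : GaussianInt) ∣ z} = ∅ := by
      rw [Set.eq_empty_iff_forall_notMem]
      rintro z ⟨hz, w, rfl⟩
      rw [Zsqrtd.norm_mul, Zsqrtd.norm_natCast] at hz
      push_cast at hz
      have hp0 : (p : ℤ) ≠ 0 := by exact_mod_cast hp.ne_zero
      have : (m : ℤ) = p * w.norm := mul_left_cancel₀ hp0 (by rw [← hz]; ring)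
      exact h (Int.natCast_dvd_natCast.mp ⟨_, this⟩)
    rw [hempty, Set.ncard_empty]

lemma star_dvd_star_gaussianInt {a b : GaussianInt} (h : a ∣ b) : star a ∣ star b := by
  obtain ⟨c, rfl⟩ := h
  exact ⟨star c, by rw [star_mul, mul_comm]⟩

lemma prime_of_norm_eq_prime {α : GaussianInt} {p : ℕ} (hp : p.Prime) (hα : α.norm = p) :
    Prime α := by
  refine Irreducible.prime ⟨?_, ?_⟩
  · rw [← Zsqrtd.norm_eq_one_iff, hα, Int.natAbs_natCast]
    exact hp.ne_one
  · rintro a b rfl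
    rw [← Zsqrtd.norm_eq_one_iff, ← Zsqrtd.norm_eq_one_iff]
    have h : a.norm.natAbs * b.norm.natAbs = p := by
      rw [← Int.natAbs_mul, ← Zsqrtd.norm_mul, hα, Int.natAbs_natCast]
    rw [← h, Nat.prime_mul_iff] at hp
    tauto

lemma gaussRep_prime_mul {p : ℕ} (hp : p.Prime) (hodd : Odd p) (m : ℕ) :
    (gaussRep (p * m) : ℤ) =
      (1 + chi p) * gaussRep m - chi p * (if p ∣ m then gaussRep (m / p) else 0 : ℕ) := by
  have : Fact p.Prime := ⟨hp⟩
  have dvd_norm : ∀ z : GaussianInt, z.norm = (p * m : ℕ) →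
      (p : GaussianInt) ∣ z * star z := by
    intro z hz
    rw [← Zsqrtd.norm_eq_mul_conj, hz]
    exact ⟨m, by push_cast; ring⟩
  rw [← ncard_norm_eq_and_prime_dvd hp]
  have hmod : p % 4 = 1 ∨ p % 4 = 3 := by
    rw [Nat.odd_iff] at hodd
    omega
  rcases hmod with h1 | h3
  · have hchi : chi p = 1 := ZMod.χ₄_nat_one_mod_four h1
    obtain ⟨a, b, hab⟩ := Nat.Prime.sq_add_sq (p := p) (by omega)
    set π : GaussianInt := ⟨a, b⟩ with hπ
    have hnorm : π.norm = p := by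
      rw [gaussianInt_norm_eq, ← hab]
      push_cast
      rfl
    have hnorm' : (star π).norm = p := by rw [Zsqrtd.norm_conj, hnorm]
    have hmul : π * star π = p := by
      rw [← Zsqrtd.norm_eq_mul_conj, hnorm, Int.cast_natCast]
    have hcop : IsCoprime π (star π) := by
      have hnd : ¬ p ∣ 2 * a := by
        intro hd
        have h2 : Nat.Coprime p 2 := Nat.coprime_two_right.mpr hodd
        have ha := h2.dvd_of_dvd_mul_left hd
        have ha0 : a ≠ 0 := by
          rintro rfl
          rw [zero_pow two_ne_zero, zero_add] at hab
          exact hp.not_isSquare ⟨b, by rw [← hab]; ring⟩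
        have := Nat.le_of_dvd (Nat.pos_of_ne_zero ha0) ha
        have := hp.two_le
        nlinarith
      have hc : IsCoprime (p : ℤ) ((2 * a : ℕ) : ℤ) :=
        Nat.isCoprime_iff_coprime.mpr ((Nat.Prime.coprime_iff_not_dvd hp).mpr hnd)
      obtain ⟨u, v, huv⟩ := hc
      refine ⟨u * star π + v, v, ?_⟩
      have hsum : π + star π = ((2 * a : ℕ) : GaussianInt) := by
        rw [Zsqrtd.ext_iff]
        simp [hπ, two_mul]
      have huv' : (u : GaussianInt) * (p : GaussianInt) +
          (v : GaussianInt) * ((2 * a : ℕ) : GaussianInt) = 1 := by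
        exact_mod_cast congrArg (Int.cast : ℤ → GaussianInt) huv
      rw [← hmul, ← hsum] at huv'
      linear_combination huv'
    have hunion : {z : GaussianInt | z.norm = (p * m : ℕ)} =
        {z : GaussianInt | z.norm = (p * m : ℕ) ∧ π ∣ z} ∪
          {z : GaussianInt | z.norm = (p * m : ℕ) ∧ star π ∣ z} := by
      ext z
      simp only [Set.mem_ofPred_eq, Set.mem_union]
      constructor
      · intro hz
        have hdvd : π ∣ z * star z := (Dvd.intro _ hmul).trans (dvd_norm z hz)
        rcases (prime_of_norm_eq_prime hp hnorm).dvd_or_dvd hdvd with h | h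
        · exact Or.inl ⟨hz, h⟩
        · have := star_dvd_star_gaussianInt h
          rw [star_star] at this
          exact Or.inr ⟨hz, this⟩
      · tauto
    have hinter : {z : GaussianInt | z.norm = (p * m : ℕ) ∧ (p : GaussianInt) ∣ z} =
        {z : GaussianInt | z.norm = (p * m : ℕ) ∧ π ∣ z} ∩
          {z : GaussianInt | z.norm = (p * m : ℕ) ∧ star π ∣ z} := by
      ext z
      simp only [Set.mem_ofPred_eq, Set.mem_inter_iff]
      constructor
      · rintro ⟨hz, h⟩
        rw [← hmul] at h
        exact ⟨⟨hz, (dvd_mul_right _ _).trans h⟩, hz, (dvd_mul_left _ _).trans h⟩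
      · rintro ⟨⟨hz, h⟩, -, h'⟩
        rw [← hmul]
        exact ⟨hz, hcop.mul_dvd h h'⟩
    have hcard := Set.ncard_union_add_ncard_inter
      {z : GaussianInt | z.norm = (p * m : ℕ) ∧ π ∣ z}
      {z : GaussianInt | z.norm = (p * m : ℕ) ∧ star π ∣ z}
      ((finite_norm_eq (p * m)).subset fun _ h => h.1)
      ((finite_norm_eq (p * m)).subset fun _ h => h.1)
    rw [← hunion, ← hinter, ncard_norm_eq_and_dvd hp.pos hnorm,
      ncard_norm_eq_and_dvd hp.pos hnorm'] at hcard
    rw [hchi, gaussRep]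
    zify at hcard
    push_cast at hcard ⊢
    linarith
  · have hchi : chi p = -1 := ZMod.χ₄_nat_three_mod_four h3
    have hprime := GaussianInt.prime_of_nat_prime_of_mod_four_eq_three p h3
    have heq : {z : GaussianInt | z.norm = (p * m : ℕ)} =
        {z : GaussianInt | z.norm = (p * m : ℕ) ∧ (p : GaussianInt) ∣ z} := by
      ext z
      simp only [Set.mem_ofPred_eq, iff_self_and]
      intro hz
      rcases hprime.dvd_or_dvd (dvd_norm z hz) with h | h
      · exact h
      · have := star_dvd_star_gaussianInt h
        rwa [star_star, star_natCast] at this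
    rw [hchi, gaussRep, heq]
    ring

lemma chiSum_prime_mul {p : ℕ} (hp : p.Prime) {m : ℕ} (hm : 0 < m) :
    chiSum (p * m) =
      (1 + chi p) * chiSum m - chi p * (if p ∣ m then chiSum (m / p) else 0) := by
  have h := chiSum_mul_chiSum hp.pos hm
  have hchi : chiSum p = 1 + chi p := by
    rw [chiSum, Nat.Prime.sum_divisors hp, chi_one, add_comm]
  rw [hchi] at h
  split_ifs with hd
  · rw [Nat.gcd_eq_left hd, Nat.Prime.sum_divisors hp, chi_one, Nat.div_one, Nat.div_one,
      Nat.div_self hp.pos, one_mul, one_mul] at h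
    linear_combination -h
  · rw [((Nat.Prime.coprime_iff_not_dvd hp).mpr hd).gcd_eq_one, Nat.divisors_one,
      sum_singleton, chi_one, Nat.div_one, Nat.div_one] at h
    linear_combination -h

/-- Jacobi's two-square theorem for odd integers. -/
theorem gaussRep_eq {m : ℕ} (hm : Odd m) : (gaussRep m : ℤ) = 4 * chiSum m := by
  induction m using Nat.strong_induction_on with
  | _ m ih =>
    by_cases h1 : m = 1
    · subst h1
      rw [gaussRep_one, chiSum, Nat.divisors_one, sum_singleton, chi_one]
      norm_num
    · obtain ⟨p, hp, k, rfl⟩ := Nat.exists_prime_and_dvd h1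
      have hk := Nat.pos_of_mul_pos_left hm.pos
      have hodd := Nat.odd_mul.mp hm
      rw [gaussRep_prime_mul hp hodd.1, chiSum_prime_mul hp hk,
        ih k (lt_mul_of_one_lt_left hk hp.one_lt) hodd.2]
      split_ifs with hd
      · obtain ⟨l, rfl⟩ := hd
        have hl := Nat.pos_of_mul_pos_left hk
        rw [Nat.mul_div_cancel_left _ hp.pos]
        have hlt : l < p * (p * l) := (lt_mul_of_one_lt_left hl hp.one_lt).trans
          (lt_mul_of_one_lt_left hk hp.one_lt)
        rw [ih l hlt (Nat.odd_mul.mp hodd.2).2]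
        ring
      · push_cast
        ring

lemma tVal_one (v : ℤ × ℤ × ℤ) : tVal 1 1 1 v = v.1 ^ 2 + v.2.1 ^ 2 + v.2.2 ^ 2 := by
  simp only [tVal, one_mul]

lemma tRep_four_mul (m : ℤ) : tRep 1 1 1 (4 * m) = tRep 1 1 1 m := by
  have hinj : Function.Injective fun v : ℤ × ℤ × ℤ => (2 * v.1, 2 * v.2.1, 2 * v.2.2) := by
    rintro ⟨x, y, z⟩ ⟨x', y', z'⟩ h
    simp only [Prod.mk.injEq] at h ⊢
    omega
  rw [tRep, tRep, ← Set.ncard_image_of_injective {v : ℤ × ℤ × ℤ | tVal 1 1 1 v = m} hinj]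
  congr 1
  ext ⟨x, y, z⟩
  simp only [Set.mem_ofPred_eq, Set.mem_image, tVal_one]
  constructor
  · intro h
    have hsq : ∀ t : ℤ, (t % 2 = 0 ∧ t ^ 2 % 4 = 0) ∨ (t % 2 = 1 ∧ t ^ 2 % 4 = 1) := by
      intro t
      rcases Int.even_or_odd' t with ⟨k, rfl | rfl⟩
      · left; ring_nf; omega
      · right; ring_nf; omega
    have hx := hsq x
    have hy := hsq y
    have hz := hsq z
    obtain ⟨a, rfl⟩ : ∃ a, x = 2 * a := ⟨x / 2, by omega⟩
    obtain ⟨b, rfl⟩ : ∃ b, y = 2 * b := ⟨y / 2, by omega⟩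
    obtain ⟨c, rfl⟩ : ∃ c, z = 2 * c := ⟨z / 2, by omega⟩
    exact ⟨(a, b, c), by linarith, rfl⟩
  · rintro ⟨⟨a, b, c⟩, h, heq⟩
    simp only [Prod.mk.injEq] at heq
    obtain ⟨rfl, rfl, rfl⟩ := heq
    rw [← h]
    ring

lemma tRep_two_pow_mul_sq (t : ℕ) (m : ℤ) :
    tRep 1 1 1 ((2 ^ t * m) ^ 2) = tRep 1 1 1 (m ^ 2) := by
  induction t with
  | zero => simp
  | succ t ih =>
    rw [← ih, ← tRep_four_mul ((2 ^ t * m) ^ 2)]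
    congr 1
    ring

lemma finite_tVal_eq (m : ℤ) : {v : ℤ × ℤ × ℤ | tVal 1 1 1 v = m}.Finite := by
  refine Set.Finite.subset ((Set.finite_Icc (-m) m).prod
    ((Set.finite_Icc (-m) m).prod (Set.finite_Icc (-m) m))) ?_
  rintro ⟨x, y, z⟩ h
  simp only [Set.mem_ofPred_eq, tVal_one] at h
  simp only [Set.mem_prod, Set.mem_Icc]
  exact ⟨abs_le_of_sq_add_eq (y := y ^ 2 + z ^ 2) (by positivity) (by linarith),
    abs_le_of_sq_add_eq (y := x ^ 2 + z ^ 2) (by positivity) (by linarith),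
    abs_le_of_sq_add_eq (y := x ^ 2 + y ^ 2) (by positivity) (by linarith)⟩

lemma card_even_second {n : ℕ} (hn : Odd n) {S : Finset (ℤ × ℤ × ℤ)}
    (hS : ∀ x y z, (x, y, z) ∈ S ↔ x ^ 2 + y ^ 2 + z ^ 2 = (n : ℤ) ^ 2) :
    ((S.filter fun v => Even v.2.1).card : ℤ) = 4 * pairSum n := by
  have bounds : ∀ v ∈ S.filter (fun v => Even v.2.1), 0 ≤ (n : ℤ) - v.2.1 ∧ 0 ≤ n + v.2.1 := by
    rintro ⟨x, y, z⟩ hv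
    rw [mem_filter, hS] at hv
    have : y ^ 2 ≤ (n : ℤ) ^ 2 := by nlinarith [sq_nonneg x, sq_nonneg z]
    have := abs_le_of_sq_le_sq' this (by positivity)
    dsimp only
    constructor <;> linarith
  have hmaps : ∀ v ∈ S.filter (fun v => Even v.2.1),
      (((n : ℤ) - v.2.1).toNat, ((n : ℤ) + v.2.1).toNat) ∈ oddPairs n := by
    intro v hv
    obtain ⟨h1, h2⟩ := bounds v hv
    have he : Even v.2.1 := (mem_filter.mp hv).2
    rw [mem_oddPairs]
    rw [Int.even_iff] at he
    rw [Nat.odd_iff] at hn ⊢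
    dsimp only
    omega
  rw [card_eq_sum_card_fiberwise hmaps, pairSum, mul_sum, Nat.cast_sum]
  refine sum_congr rfl ?_
  rintro ⟨a, b⟩ hab
  rw [mem_oddPairs] at hab
  obtain ⟨hab, ha⟩ := hab
  dsimp only at hab ha
  have hb : Odd b := by
    rw [Nat.odd_iff] at *
    omega
  rw [← gaussRep_eq (ha.mul hb), gaussRep, Nat.cast_inj, ← Set.ncard_coe_finset]
  have hab' : (a : ℤ) + b = 2 * n := by exact_mod_cast hab
  symm
  refine Set.ncard_congr (fun (w : GaussianInt) _ => (w.re, (n : ℤ) - a, w.im)) ?_ ?_ ?_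
  · intro w hw
    simp only [Set.mem_ofPred_eq, gaussianInt_norm_eq] at hw
    rw [mem_coe, mem_filter, mem_filter, hS]
    refine ⟨⟨?_, ?_⟩, ?_⟩
    · push_cast at hw
      have hb' : (b : ℤ) = 2 * n - a := by linarith
      rw [hb'] at hw
      linear_combination hw
    · rw [Int.even_iff]
      rw [Nat.odd_iff] at *
      dsimp only
      omega
    · simp only [Prod.mk.injEq]
      omega
  · intro w w' _ _ h
    simp only [Prod.mk.injEq] at h
    exact Zsqrtd.ext h.1 h.2.2
  · rintro ⟨x, y, z⟩ hv
    rw [mem_coe, mem_filter] at hv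
    obtain ⟨hv, hf⟩ := hv
    obtain ⟨h1, h2⟩ := bounds _ hv
    rw [mem_filter, hS] at hv
    simp only [Prod.mk.injEq] at hf h1 h2
    have hya : (n : ℤ) - y = a := by omega
    have hyb : (n : ℤ) + y = b := by omega
    refine ⟨⟨x, z⟩, ?_, ?_⟩
    · simp only [Set.mem_ofPred_eq, gaussianInt_norm_eq]
      push_cast
      rw [← hya, ← hyb]
      linear_combination hv.1
    · simp only [Prod.mk.injEq, true_and, and_true]
      linarith

/-- The number of representations of an odd square as a sum of three squares. -/
lemma tRep_sq {n : ℕ} (hn : Odd n) : (tRep 1 1 1 ((n : ℤ) ^ 2) : ℤ) = 6 * pairSum n := by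
  have hfin := finite_tVal_eq ((n : ℤ) ^ 2)
  set S : Finset (ℤ × ℤ × ℤ) := hfin.toFinset with hSdef
  have hS : ∀ x y z, (x, y, z) ∈ S ↔ x ^ 2 + y ^ 2 + z ^ 2 = (n : ℤ) ^ 2 := by
    intro x y z
    rw [hSdef, Set.Finite.mem_toFinset, Set.mem_ofPred_eq, tVal_one]
  have hrep : tRep 1 1 1 ((n : ℤ) ^ 2) = S.card := by
    rw [tRep, Set.ncard_eq_toFinset_card _ hfin]
  have h2 := card_even_second hn hS
  have h1 : (S.filter fun v => Even v.1).card = (S.filter fun v => Even v.2.1).card := by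
    refine card_nbij' (fun v => (v.2.1, v.1, v.2.2)) (fun v => (v.2.1, v.1, v.2.2)) ?_ ?_
      (fun _ _ => rfl) (fun _ _ => rfl) <;>
    · rintro ⟨x, y, z⟩ h
      simp only [coe_filter, Set.mem_ofPred_eq, hS] at h ⊢
      exact ⟨by linarith, h.2⟩
  have h3 : (S.filter fun v => Even v.2.2).card = (S.filter fun v => Even v.2.1).card := by
    refine card_nbij' (fun v => (v.1, v.2.2, v.2.1)) (fun v => (v.1, v.2.2, v.2.1)) ?_ ?_
      (fun _ _ => rfl) (fun _ _ => rfl) <;>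
    · rintro ⟨x, y, z⟩ h
      simp only [coe_filter, Set.mem_ofPred_eq, hS] at h ⊢
      exact ⟨by linarith, h.2⟩
  have hsum : (S.filter fun v => Even v.1).card + (S.filter fun v => Even v.2.1).card +
      (S.filter fun v => Even v.2.2).card = 2 * S.card := by
    simp only [card_filter]
    rw [← sum_add_distrib, ← sum_add_distrib, mul_comm, ← smul_eq_mul, ← sum_const]
    refine sum_congr rfl ?_
    rintro ⟨x, y, z⟩ hv
    rw [hS] at hv
    have hsq : ∀ t : ℤ, (Even t ∧ t ^ 2 % 4 = 0) ∨ (¬ Even t ∧ t ^ 2 % 4 = 1) := by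
      intro t
      rcases Int.even_or_odd' t with ⟨k, rfl | rfl⟩
      · left; exact ⟨even_two_mul k, by ring_nf; omega⟩
      · right; exact ⟨Int.not_even_two_mul_add_one k, by ring_nf; omega⟩
    have hn2 : (n : ℤ) ^ 2 % 4 = 1 := by
      rcases hsq n with h | h
      · exact absurd ((Int.even_coe_nat n).mp h.1) (Nat.not_even_iff_odd.mpr hn)
      · exact h.2
    rcases hsq x with ⟨hx, hx'⟩ | ⟨hx, hx'⟩ <;> rcases hsq y with ⟨hy, hy'⟩ | ⟨hy, hy'⟩ <;>
      rcases hsq z with ⟨hz, hz'⟩ | ⟨hz, hz'⟩ <;> simp only [hx, hy, hz, if_true, if_false] <;>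
      omega
  rw [hrep]
  rw [h1, h3] at hsum
  zify at hsum
  linarith

lemma tHp_eq_pairSum {p : ℕ} (hp : p.Prime) (hodd : Odd p) (k : ℕ) :
    tHp 1 1 1 p (k + 1) = pairSum (p ^ (k + 1)) := by
  have hp1 : (p : ℤ) - 1 ≠ 0 := by
    have := hp.one_lt
    omega
  have hgeom : ∀ m : ℕ, ((p : ℤ) ^ m - 1) / ((p : ℤ) - 1) = ∑ i ∈ range m, (p : ℤ) ^ i :=
    fun m => Int.ediv_eq_of_eq_mul_left hp1 (geom_sum_mul _ _).symm
  have hJ : jacobiSym (-(1 * 1 * 1)) p = chi p := by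
    rw [mul_one, mul_one, jacobiSym.at_neg_one hodd]
    rfl
  rw [tHp, hgeom, hgeom, hJ, pairSum_prime_pow hp hodd]

lemma tRep_eq_prod_tHp {n : ℕ} (hn : Odd n) :
    (tRep 1 1 1 ((n : ℤ) ^ 2) : ℤ) = 6 * ∏ p ∈ n.primeFactors, tHp 1 1 1 p (n.factorization p) := by
  rw [tRep_sq hn, pairSum_eq_prod hn]
  congr 1
  refine prod_congr rfl fun p hp => ?_
  have hpp := Nat.prime_of_mem_primeFactors hp
  have hdvd := Nat.dvd_of_mem_primeFactors hp
  obtain ⟨k, hk⟩ := Nat.exists_eq_add_one.mpr (hpp.factorization_pos_of_dvd hn.pos.ne' hdvd)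
  rw [hk, tHp_eq_pairSum hpp (hn.of_dvd_nat hdvd)]

/-- The ternary form `x² + 1y² + 1z²`-type form `⟨1,1,1⟩` is strongly s-regular. -/
theorem stmt_14 (n₁ n₂ : ℕ) (h₁ : 0 < n₁) (h₂ : 0 < n₂)
    (hpow : ∃ t : ℕ, n₁ = 2 ^ t) (hodd : Odd n₂) :
    (tRep 1 1 1 (((n₁ : ℤ) * (n₂ : ℤ)) ^ 2) : ℤ) =
      (tRep 1 1 1 ((n₁ : ℤ) ^ 2) : ℤ) *
        ∏ p ∈ n₂.primeFactors, tHp 1 1 1 p (n₂.factorization p) := by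
  obtain ⟨t, rfl⟩ := hpow
  have h := tRep_two_pow_mul_sq t 1
  have h1 := tRep_eq_prod_tHp odd_one
  rw [Nat.primeFactors_one, prod_empty, Nat.cast_one] at h1
  rw [mul_one] at h
  push_cast
  rw [tRep_two_pow_mul_sq, tRep_eq_prod_tHp hodd, h, h1, mul_one]
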